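/- arXiv:1603.06870 — 3 statements merged into one kernel-verified Lean document; each statement's English description precedes it below -/
import Mathlib

section
/- Lower bound on the value of privacy (Theorem 1): For any number N ≥ 1 of individuals, any nonnegative payment mechanism R : X^N → ℝ^N, any Nash equilibrium σ of R, any individual i, and any ε > 0, if the privacy level of individual i's equilibrium strategy σ_i equals ε, then the expected payment to individual i at this equilibrium satisfies E_σ[R_i(X)] ≥ V_LB(ε) = g'(ε)·((e^ε+1)/e^ε)·((θ/(2θ−1))·(e^ε+1) − 1). -/
open Real

/-- The set of possible reports: `some b` is report `b ∈ {0,1}`, `none` is nonparticipation `⊥`. -/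
abbrev Report := Option Bool

/-- A (behavioral) strategy: a conditional distribution of the report given the signal. -/
def IsStrategy (σ : Bool → Report → ℝ) : Prop :=
  (∀ s x, 0 ≤ σ s x) ∧ ∀ s, ∑ x : Report, σ s x = 1

/-- `P_σ(X ∈ E | S = s)`. -/
def probE (σ : Bool → Report → ℝ) (E : Finset Report) (s : Bool) : ℝ :=
  ∑ x ∈ E, σ s x

/-- One log-likelihood-ratio term `ln(a/b)`, with the convention `0/0 = 1`,
clamped into `[0,∞]` (this does not change the supremum defining the privacy level,
since the supremum is always ≥ 0). -/
noncomputable def llr (a b : ℝ) : ENNReal :=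
  if a = 0 ∧ b = 0 then 0
  else if b = 0 then ⊤
  else ENNReal.ofReal (Real.log (a / b))

/-- The (local) differential privacy level `ζ(σ)` of a strategy, valued in `[0,∞]`. -/
noncomputable def privLevel (σ : Bool → Report → ℝ) : ENNReal :=
  ⨆ (E : Finset Report), ⨆ (s : Bool), llr (probE σ E s) (probE σ E (!s))

/-- The privacy cost `g(ζ(σ))`, valued in extended reals (at `ζ = ∞` we take the
supremum extension of `g`). -/
noncomputable def privCost (g : ℝ → ℝ) (σ : Bool → Report → ℝ) : EReal :=
  if privLevel σ = ⊤ then ⨆ x ∈ Set.Ici (0:ℝ), ((g x : ℝ) : EReal)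
  else ((g (privLevel σ).toReal : ℝ) : EReal)

/-- `P(S_i = s | W = w) = θ` if `s = w`, else `1 - θ`. -/
def signalProb (θ : ℝ) (w s : Bool) : ℝ := if s = w then θ else 1 - θ

/-- Joint probability of state `w`, signals `s` and reports `x`, where `p = P_W(1)`. -/
def jointProb {N : ℕ} (p θ : ℝ) (σ : Fin N → Bool → Report → ℝ)
    (w : Bool) (s : Fin N → Bool) (x : Fin N → Report) : ℝ :=
  (if w then p else 1 - p) * ∏ i, (signalProb θ w (s i) * σ i (s i) (x i))

/-- Expected payment `E_σ[R_i(X)]` to individual `i`. -/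
noncomputable def expPay {N : ℕ} (p θ : ℝ) (σ : Fin N → Bool → Report → ℝ)
    (R : (Fin N → Report) → Fin N → ℝ) (i : Fin N) : ℝ :=
  ∑ w : Bool, ∑ s : Fin N → Bool, ∑ x : Fin N → Report,
    jointProb p θ σ w s x * R x i

/-- Expected utility of individual `i`: expected payment minus privacy cost. -/
noncomputable def utility {N : ℕ} (p θ : ℝ) (g : ℝ → ℝ)
    (σ : Fin N → Bool → Report → ℝ)
    (R : (Fin N → Report) → Fin N → ℝ) (i : Fin N) : EReal :=
  ((expPay p θ σ R i : ℝ) : EReal) - privCost g (σ i)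

/-- `σ` is a Nash equilibrium of the payment mechanism `R`. -/
def NashEq {N : ℕ} (p θ : ℝ) (g : ℝ → ℝ)
    (σ : Fin N → Bool → Report → ℝ)
    (R : (Fin N → Report) → Fin N → ℝ) : Prop :=
  (∀ i, IsStrategy (σ i)) ∧
  ∀ (i : Fin N) (σ' : Bool → Report → ℝ), IsStrategy σ' →
    utility p θ g (Function.update σ i σ') R i ≤ utility p θ g σ R i

/-- The `ε`-strategy: symmetric randomized response flipping with prob. `1/(e^ε+1)`. -/
noncomputable def epsStrategy (ε : ℝ) : Bool → Report → ℝ :=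
  fun s x => match x with
  | none => 0
  | some b => if b = s then Real.exp ε / (Real.exp ε + 1) else 1 / (Real.exp ε + 1)

/-- The lower bound `V_LB(ε)` on the value of `ε` units of privacy. -/
noncomputable def VLB (θ : ℝ) (g' : ℝ → ℝ) (ε : ℝ) : ℝ :=
  g' ε * ((Real.exp ε + 1) / Real.exp ε) *
    ((θ / (2 * θ - 1)) * (Real.exp ε + 1) - 1)

/-- The hypotheses on the privacy cost function `g` (with derivative `g'`):
proper (nonnegative, `g(0) = 0`, non-decreasing), convex, continuously differentiable,
and vanishing only at `0`. -/
structure ProperCost (g g' : ℝ → ℝ) : Prop where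
  conv : ConvexOn ℝ (Set.Ici 0) g
  deriv : ∀ x ∈ Set.Ici (0:ℝ), HasDerivAt g (g' x) x
  derivCont : ContinuousOn g' (Set.Ici 0)
  mono : MonotoneOn g (Set.Ici 0)
  nonneg : ∀ x ∈ Set.Ici (0:ℝ), 0 ≤ g x
  zero : g 0 = 0
  pos : ∀ x > (0:ℝ), 0 < g x

section Deviation

open Filter Topology Finset

/-- The strategy that follows `σ` on the reversed signal with probability `t`. -/
def flipMix (σ : Bool → Report → ℝ) (t : ℝ) : Bool → Report → ℝ :=
  fun s x => (1 - t) * σ s x + t * σ (!s) x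

lemma isStrategy_flipMix {σ : Bool → Report → ℝ} (h : IsStrategy σ) {t : ℝ}
    (ht0 : 0 ≤ t) (ht1 : t ≤ 1) : IsStrategy (flipMix σ t) := by
  refine ⟨fun s x => ?_, fun s => ?_⟩
  · have h1 := mul_nonneg (sub_nonneg.2 ht1) (h.1 s x)
    have h2 := mul_nonneg ht0 (h.1 (!s) x)
    exact add_nonneg h1 h2
  · simp only [flipMix, sum_add_distrib, ← mul_sum, h.2]
    ring

lemma le_exp_mul_of_privLevel_le {σ : Bool → Report → ℝ} (h : IsStrategy σ) {ε : ℝ}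
    (hε : 0 ≤ ε) (hlev : privLevel σ ≤ ENNReal.ofReal ε) (s : Bool) (x : Report) :
    σ s x ≤ exp ε * σ (!s) x := by
  have hl : llr (σ s x) (σ (!s) x) ≤ ENNReal.ofReal ε := by
    have := (le_iSup₂ (f := fun (E : Finset Report) (s : Bool) =>
      llr (probE σ E s) (probE σ E (!s))) {x} s).trans hlev
    simpa [probE] using this
  rcases (h.1 s x).eq_or_lt with ha | ha
  · rw [← ha]
    exact mul_nonneg (exp_pos _).le (h.1 _ _)
  rcases (h.1 (!s) x).eq_or_lt with hb | hb
  · simp [llr, ← hb, ha.ne'] at hl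
  rw [llr, if_neg (by simp [ha.ne']), if_neg hb.ne', ENNReal.ofReal_le_ofReal_iff hε,
    log_le_iff_le_exp (by positivity), div_le_iff₀ hb] at hl
  exact hl

lemma privLevel_le_of_le_exp_mul {σ : Bool → Report → ℝ} (h : IsStrategy σ) {ε : ℝ}
    (hle : ∀ s x, σ s x ≤ exp ε * σ (!s) x) : privLevel σ ≤ ENNReal.ofReal ε := by
  refine iSup₂_le fun E s => ?_
  have h0 : ∀ s, 0 ≤ probE σ E s := fun s => sum_nonneg fun x _ => h.1 s x
  have hE : probE σ E s ≤ exp ε * probE σ E (!s) := by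
    simp only [probE, mul_sum]
    exact sum_le_sum fun x _ => hle s x
  unfold llr
  split_ifs with h1 h2
  · exact zero_le
  · rw [h2, mul_zero] at hE
    exact absurd ⟨le_antisymm hE (h0 s), h2⟩ h1
  · have hb := (h0 (!s)).lt_of_ne' h2
    rcases (h0 s).eq_or_lt with ha | ha
    · simp [← ha]
    · refine ENNReal.ofReal_le_ofReal ?_
      rwa [log_le_iff_le_exp (by positivity), div_le_iff₀ hb]

/-- Mixing with the reversed signal lowers the odds bound `E` to
`((1 - t) E + t) / ((1 - t) + t E)`. -/
lemma privLevel_flipMix_le {σ : Bool → Report → ℝ} (h : IsStrategy σ) {E t : ℝ} (hE : 0 < E)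
    (ht0 : 0 ≤ t) (ht1 : t ≤ 1 / 2) (hle : ∀ s x, σ s x ≤ E * σ (!s) x) :
    privLevel (flipMix σ t) ≤
      ENNReal.ofReal (log (((1 - t) * E + t) / ((1 - t) + t * E))) := by
  have hN : 0 < (1 - t) * E + t := by nlinarith
  have hD : 0 < (1 - t) + t * E := by nlinarith
  refine privLevel_le_of_le_exp_mul (isStrategy_flipMix h ht0 (by linarith)) fun s x => ?_
  rw [exp_log (div_pos hN hD), div_mul_eq_mul_div, le_div_iff₀ hD]
  have := mul_nonneg (by linarith : 0 ≤ 1 - 2 * t) (sub_nonneg.2 (hle s x))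
  simp only [flipMix, Bool.not_not]
  linarith

/-- Probability that an individual using the strategy `σ` reports `x` in state `w`. -/
def reportProb (θ : ℝ) (σ : Bool → Report → ℝ) (w : Bool) (x : Report) : ℝ :=
  ∑ b : Bool, signalProb θ w b * σ b x

lemma signalProb_nonneg {θ : ℝ} (h0 : 0 ≤ θ) (h1 : θ ≤ 1) (w s : Bool) :
    0 ≤ signalProb θ w s := by
  unfold signalProb
  split_ifs <;> linarith

lemma reportProb_nonneg {θ : ℝ} (h0 : 0 ≤ θ) (h1 : θ ≤ 1) {σ : Bool → Report → ℝ}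
    (h : IsStrategy σ) (w : Bool) (x : Report) : 0 ≤ reportProb θ σ w x :=
  sum_nonneg fun b _ => mul_nonneg (signalProb_nonneg h0 h1 w b) (h.1 b x)

lemma expPay_eq_sum_reportProb {N : ℕ} (p θ : ℝ) (σ : Fin N → Bool → Report → ℝ)
    (R : (Fin N → Report) → Fin N → ℝ) (i : Fin N) :
    expPay p θ σ R i = ∑ w : Bool, ∑ x : Fin N → Report,
      (if w then p else 1 - p) * (∏ j, reportProb θ (σ j) w (x j)) * R x i := by
  unfold expPay
  refine sum_congr rfl fun w _ => ?_
  rw [sum_comm]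
  refine sum_congr rfl fun x _ => ?_
  simp only [jointProb, ← sum_mul, ← mul_sum, reportProb]
  rw [Fintype.prod_sum]

/-- If changing the strategy of `i` scales every conditional report probability by at least `c`,
then it scales her expected payment by at least `c`. -/
lemma mul_expPay_le_expPay_update {N : ℕ} {p θ : ℝ} (hp0 : 0 ≤ p) (hp1 : p ≤ 1)
    (h0 : 0 ≤ θ) (h1 : θ ≤ 1) {σ : Fin N → Bool → Report → ℝ} (hσ : ∀ j, IsStrategy (σ j))
    {R : (Fin N → Report) → Fin N → ℝ} (hR : ∀ x i, 0 ≤ R x i) (i : Fin N)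
    {τ : Bool → Report → ℝ} {c : ℝ}
    (hc : ∀ w x, c * reportProb θ (σ i) w x ≤ reportProb θ τ w x) :
    c * expPay p θ σ R i ≤ expPay p θ (Function.update σ i τ) R i := by
  simp only [expPay_eq_sum_reportProb, mul_sum]
  refine sum_le_sum fun w _ => sum_le_sum fun x _ => ?_
  rw [← mul_prod_erase univ _ (mem_univ i), ← mul_prod_erase univ _ (mem_univ i),
    Function.update_self]
  have hprod : ∏ j ∈ univ.erase i, reportProb θ (Function.update σ i τ j) w (x j) =
      ∏ j ∈ univ.erase i, reportProb θ (σ j) w (x j) :=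
    prod_congr rfl fun j hj => by rw [Function.update_of_ne (ne_of_mem_erase hj)]
  rw [hprod]
  have hw : 0 ≤ (if w then p else 1 - p) := by split_ifs <;> linarith
  have hP : 0 ≤ ∏ j ∈ univ.erase i, reportProb θ (σ j) w (x j) :=
    prod_nonneg fun j _ => reportProb_nonneg h0 h1 (hσ j) w (x j)
  have := mul_le_mul_of_nonneg_right (hc w (x i)) (mul_nonneg (mul_nonneg hw hP) (hR x i))
  linarith

lemma mul_reportProb_le_reportProb_flipMix {θ E t : ℝ} (hθ : 1 / 2 < θ) (hθ1 : θ < 1)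
    (hE : 0 < E) (ht0 : 0 ≤ t) {σ : Bool → Report → ℝ}
    (hle : ∀ s x, σ s x ≤ E * σ (!s) x) (w : Bool) (x : Report) :
    (1 - (2 * θ - 1) * (E - 1) / (θ * E + 1 - θ) * t) * reportProb θ σ w x ≤
      reportProb θ (flipMix σ t) w x := by
  have hD : 0 < θ * E + 1 - θ := by nlinarith
  have hkey : 0 ≤ (2 * θ - 1) / (θ * E + 1 - θ) * t * (E * σ (!w) x - σ w x) :=
    mul_nonneg (mul_nonneg (div_nonneg (by linarith) hD.le) ht0) (sub_nonneg.2 (hle w x))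
  have hid : reportProb θ (flipMix σ t) w x -
      (1 - (2 * θ - 1) * (E - 1) / (θ * E + 1 - θ) * t) * reportProb θ σ w x =
      (2 * θ - 1) / (θ * E + 1 - θ) * t * (E * σ (!w) x - σ w x) := by
    cases w <;> simp [reportProb, signalProb, flipMix] <;> field_simp <;> ring
  linarith

/-- In a Nash equilibrium, any deviation of finite privacy level has to lose in payment at least
what it gains in privacy cost. -/
lemma expPay_update_add_cost_le {N : ℕ} {p θ : ℝ} {g g' : ℝ → ℝ} (hg : ProperCost g g')
    {R : (Fin N → Report) → Fin N → ℝ} {σ : Fin N → Bool → Report → ℝ}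
    (hNE : NashEq p θ g σ R) {i : Fin N} {ε δ : ℝ} (hε : 0 ≤ ε) (hδ : 0 ≤ δ)
    (hlev : privLevel (σ i) = ENNReal.ofReal ε) {τ : Bool → Report → ℝ} (hτ : IsStrategy τ)
    (hτlev : privLevel τ ≤ ENNReal.ofReal δ) :
    expPay p θ (Function.update σ i τ) R i + g ε ≤ expPay p θ σ R i + g δ := by
  have h := hNE.2 i τ hτ
  have hτtop : privLevel τ ≠ ⊤ := (hτlev.trans_lt ENNReal.ofReal_lt_top).ne
  have hmono : g (privLevel τ).toReal ≤ g δ :=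
    hg.mono (Set.mem_Ici.2 ENNReal.toReal_nonneg) hδ (ENNReal.toReal_le_of_le_ofReal hδ hτlev)
  rw [utility, utility, Function.update_self, privCost, privCost, if_neg hτtop, hlev,
    if_neg ENNReal.ofReal_ne_top, ENNReal.toReal_ofReal hε, ← EReal.coe_sub, ← EReal.coe_sub,
    EReal.coe_le_coe_iff] at h
  linarith

lemma HasDerivAt.nonneg_of_eventually_ge {f : ℝ → ℝ} {d a : ℝ} (hf : HasDerivAt f d a)
    (h : ∀ᶠ t in 𝓝[>] a, f a ≤ f t) : 0 ≤ d := by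
  refine ge_of_tendsto (hf.tendsto_slope.mono_left
    (nhdsGT_le_nhdsNE a)) ?_
  filter_upwards [h, self_mem_nhdsWithin] with t ht hat
  rw [slope_def_field]
  exact div_nonneg (sub_nonneg.2 ht) (sub_nonneg.2 (le_of_lt hat))

lemma hasDerivAt_log_mix_odds {E : ℝ} (hE : 0 < E) :
    HasDerivAt (fun t : ℝ => log (((1 - t) * E + t) / ((1 - t) + t * E)))
      (-((E - 1) * (E + 1) / E)) 0 := by
  have hid := hasDerivAt_id' (0 : ℝ)
  have hN := ((hid.const_sub 1).mul_const E).add hid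
  have hD := (hid.const_sub 1).add (hid.mul_const E)
  have h := (hN.div hD (by simp)).log (by simpa using hE.ne')
  refine h.congr_deriv ?_
  simp
  field_simp
  ring

end Deviation

/-- **Theorem 1 (lower bound on the value of privacy).**
For any `N ≥ 1`, any nonnegative payment mechanism `R`, any Nash equilibrium `σ` of `R`,
any individual `i` and any `ε > 0`, if the privacy level of `σ i` equals `ε`, then the
expected payment to `i` at this equilibrium is at least `V_LB(ε)`. -/
theorem value_of_privacy_lower_bound
    (N : ℕ) (hN : 1 ≤ N) (p θ : ℝ) (hp0 : 0 < p) (hp1 : p < 1)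
    (hθ : 1/2 < θ) (hθ1 : θ < 1)
    (g g' : ℝ → ℝ) (hg : ProperCost g g')
    (R : (Fin N → Report) → Fin N → ℝ) (hR : ∀ x i, 0 ≤ R x i)
    (σ : Fin N → Bool → Report → ℝ)
    (hNE : NashEq p θ g σ R)
    (i : Fin N) (ε : ℝ) (hε : 0 < ε)
    (hlev : privLevel (σ i) = ENNReal.ofReal ε) :
    VLB θ g' ε ≤ expPay p θ σ R i := by
  have hσ := hNE.1
  have hE : 1 < exp ε := one_lt_exp_iff.2 hε
  have hle := le_exp_mul_of_privLevel_le (hσ i) hε.le hlev.le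
  set E := exp ε with hEdef
  set V := expPay p θ σ R i
  set c := (2 * θ - 1) * (E - 1) / (θ * E + 1 - θ) with hc
  let δ : ℝ → ℝ := fun t => log (((1 - t) * E + t) / ((1 - t) + t * E))
  have hδ0 : δ 0 = ε := by simp [δ, hEdef]
  have hloss : ∀ t ∈ Set.Ioo (0 : ℝ) (1 / 2), g ε ≤ g (δ t) + c * V * t := by
    rintro t ⟨ht0, ht1⟩
    have hD : 0 < (1 - t) + t * E := by nlinarith
    have hδ : 0 ≤ δ t := log_nonneg (by rw [le_div_iff₀ hD]; nlinarith)
    have h := expPay_update_add_cost_le hg hNE hε.le hδ hlev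
      (isStrategy_flipMix (hσ i) ht0.le (by linarith))
      (privLevel_flipMix_le (hσ i) (by linarith) ht0.le ht1.le hle)
    have h' := mul_expPay_le_expPay_update hp0.le hp1.le (by linarith) hθ1.le hσ hR i
      (mul_reportProb_le_reportProb_flipMix hθ hθ1 (by linarith : 0 < E) ht0.le hle)
    linarith
  have hgδ : HasDerivAt g (g' ε) (δ 0) := by
    rw [hδ0]
    exact hg.deriv ε hε.le
  have hderiv : HasDerivAt (fun t => g (δ t) + c * V * t)
      (g' ε * (-((E - 1) * (E + 1) / E)) + c * V * 1) 0 :=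
    (hgδ.comp (0 : ℝ) (hasDerivAt_log_mix_odds (by linarith))).add
      ((hasDerivAt_id' (0 : ℝ)).const_mul (c * V))
  have hnonneg := hderiv.nonneg_of_eventually_ge <| by
    filter_upwards [Ioo_mem_nhdsGT (by norm_num : (0 : ℝ) < 1 / 2)] with t ht
    simpa [hδ0] using hloss t ht
  have hE0 : 0 < E := by linarith
  have hD : 0 < θ * E + 1 - θ := by nlinarith
  have h2θ : 0 < 2 * θ - 1 := by linarith
  have hcpos : 0 < c := div_pos (mul_pos h2θ (by linarith)) hD
  refine le_of_mul_le_mul_left ?_ hcpos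
  have hVLB : c * VLB θ g' ε = g' ε * ((E - 1) * (E + 1) / E) := by
    rw [VLB, ← hEdef, hc]
    field_simp
    ring
  linarith
end

section
/- Sign-flipping replication (Lemma 2): For any nonnegative payment mechanism R : X^N → ℝ^N, any individual i, any ε > 0, and any strategies σ_{−i} of the other individuals, if the strategy profile (σ_i^{(−ε)}, σ_{−i}) is a Nash equilibrium of R, then there exists a nonnegative payment mechanism R' : X^N → ℝ^N such that (σ_i^{(ε)}, σ_{−i}) is a Nash equilibrium of R' and, for every individual j, the expected payment to j at the equilibrium (σ_i^{(ε)}, σ_{−i}) of R' equals the expected payment to j at the equilibrium (σ_i^{(−ε)}, σ_{−i}) of R. -/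
open Real

/-- Post-process the report of a strategy by the permutation `φ`. -/
def relabelStrategy (φ : Equiv.Perm Report) (τ : Bool → Report → ℝ) : Bool → Report → ℝ :=
  fun s x => τ s (φ.symm x)

/-- The mechanism that permutes the report of each individual `k` by `φ k` before applying `R`. -/
def relabelMechanism {N : ℕ} (φ : Fin N → Equiv.Perm Report)
    (R : (Fin N → Report) → Fin N → ℝ) : (Fin N → Report) → Fin N → ℝ :=
  fun x => R fun k => φ k (x k)

/-- The permutation of reports exchanging `0` and `1` and fixing nonparticipation. -/
def flipReport : Equiv.Perm Report := Equiv.optionCongr Equiv.boolNot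

theorem IsStrategy.relabel {τ : Bool → Report → ℝ} (h : IsStrategy τ) (φ : Equiv.Perm Report) :
    IsStrategy (relabelStrategy φ τ) :=
  ⟨fun s _ => h.1 s _, fun s => (Equiv.sum_comp φ.symm (τ s)).trans (h.2 s)⟩

theorem relabelStrategy_one (τ : Bool → Report → ℝ) : relabelStrategy 1 τ = τ := rfl

theorem probE_relabelStrategy (φ : Equiv.Perm Report) (τ : Bool → Report → ℝ)
    (E : Finset Report) (s : Bool) :
    probE (relabelStrategy φ τ) E s = probE τ (φ.symm.finsetCongr E) s := by
  simp [probE, relabelStrategy]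

theorem privLevel_relabelStrategy (φ : Equiv.Perm Report) (τ : Bool → Report → ℝ) :
    privLevel (relabelStrategy φ τ) = privLevel τ := by
  simp only [privLevel, probE_relabelStrategy]
  exact φ.symm.finsetCongr.iSup_comp
    (g := fun E => ⨆ s : Bool, llr (probE τ E s) (probE τ E (!s)))

theorem privCost_relabelStrategy (g : ℝ → ℝ) (φ : Equiv.Perm Report) (τ : Bool → Report → ℝ) :
    privCost g (relabelStrategy φ τ) = privCost g τ := by
  simp only [privCost, privLevel_relabelStrategy]

theorem expPay_relabelMechanism {N : ℕ} (p θ : ℝ) (φ : Fin N → Equiv.Perm Report)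
    (τ : Fin N → Bool → Report → ℝ) (R : (Fin N → Report) → Fin N → ℝ) (j : Fin N) :
    expPay p θ τ (relabelMechanism φ R) j =
      expPay p θ (fun k => relabelStrategy (φ k) (τ k)) R j := by
  unfold expPay
  refine Finset.sum_congr rfl fun w _ => Finset.sum_congr rfl fun s _ => ?_
  refine Fintype.sum_equiv (Equiv.piCongrRight φ) _ _ fun x => ?_
  have hmech : relabelMechanism φ R x = R (Equiv.piCongrRight φ x) := rfl
  simp [jointProb, relabelStrategy, hmech]

theorem utility_relabelMechanism {N : ℕ} (p θ : ℝ) (g : ℝ → ℝ) (φ : Fin N → Equiv.Perm Report)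
    (τ : Fin N → Bool → Report → ℝ) (R : (Fin N → Report) → Fin N → ℝ) (j : Fin N) :
    utility p θ g τ (relabelMechanism φ R) j =
      utility p θ g (fun k => relabelStrategy (φ k) (τ k)) R j := by
  simp only [utility, expPay_relabelMechanism, privCost_relabelStrategy]

theorem relabelStrategy_update {N : ℕ} (φ : Fin N → Equiv.Perm Report)
    (τ : Fin N → Bool → Report → ℝ) (j : Fin N) (τ' : Bool → Report → ℝ) :
    (fun k => relabelStrategy (φ k) (Function.update τ j τ' k)) =
      Function.update (fun k => relabelStrategy (φ k) (τ k)) j (relabelStrategy (φ j) τ') := by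
  funext k
  exact Function.apply_update (fun k => relabelStrategy (φ k)) τ j τ' k

/-- A profile is an equilibrium of a relabelled mechanism if its relabelling is one of the
original mechanism. -/
theorem NashEq.of_relabel {N : ℕ} {p θ : ℝ} {g : ℝ → ℝ} {φ : Fin N → Equiv.Perm Report}
    {τ : Fin N → Bool → Report → ℝ} {R : (Fin N → Report) → Fin N → ℝ}
    (hτ : ∀ k, IsStrategy (τ k))
    (h : NashEq p θ g (fun k => relabelStrategy (φ k) (τ k)) R) :
    NashEq p θ g τ (relabelMechanism φ R) := by
  refine ⟨hτ, fun j τ' hτ' => ?_⟩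
  rw [utility_relabelMechanism, utility_relabelMechanism, relabelStrategy_update]
  exact h.2 j _ (hτ'.relabel (φ j))

theorem isStrategy_epsStrategy (ε : ℝ) : IsStrategy (epsStrategy ε) := by
  refine ⟨fun s x => ?_, fun s => ?_⟩
  · rcases x with _ | b
    · exact le_rfl
    · simp only [epsStrategy]
      split_ifs <;> positivity
  · have h : Real.exp ε + 1 ≠ 0 := by positivity
    cases s <;> simp [epsStrategy, Fintype.sum_option] <;> field_simp
    ring

theorem relabelStrategy_flipReport_epsStrategy (ε : ℝ) :
    relabelStrategy flipReport (epsStrategy ε) = epsStrategy (-ε) := by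
  funext s x
  have h := Real.exp_pos ε
  rcases x with _ | b
  · rfl
  · have hflip : relabelStrategy flipReport (epsStrategy ε) s (some b) =
        epsStrategy ε s (some !b) := rfl
    rw [hflip]
    cases s <;> cases b <;> simp [epsStrategy, Real.exp_neg] <;> field_simp <;> ring

/-- **Lemma 2 (sign-flipping replication).**
If `(σ_i^{(−ε)}, σ_{−i})` is a Nash equilibrium of a nonnegative mechanism `R`, then there
is a nonnegative mechanism `R'` in which `(σ_i^{(ε)}, σ_{−i})` is a Nash equilibrium with
the same expected payment to every individual. -/
theorem sign_flipping_replication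
    (N : ℕ) (hN : 1 ≤ N) (p θ : ℝ) (hp0 : 0 < p) (hp1 : p < 1)
    (hθ : 1/2 < θ) (hθ1 : θ < 1)
    (g g' : ℝ → ℝ) (hg : ProperCost g g')
    (R : (Fin N → Report) → Fin N → ℝ) (hR : ∀ x i, 0 ≤ R x i)
    (σ : Fin N → Bool → Report → ℝ)
    (i : Fin N) (ε : ℝ) (hε : 0 < ε)
    (hσi : σ i = epsStrategy (-ε))
    (hNE : NashEq p θ g σ R) :
    ∃ R' : (Fin N → Report) → Fin N → ℝ,
      (∀ x j, 0 ≤ R' x j) ∧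
      NashEq p θ g (Function.update σ i (epsStrategy ε)) R' ∧
      ∀ j : Fin N,
        expPay p θ (Function.update σ i (epsStrategy ε)) R' j = expPay p θ σ R j := by
  set φ : Fin N → Equiv.Perm Report := Function.update 1 i flipReport with hφ
  have hprofile : (fun k => relabelStrategy (φ k)
      (Function.update σ i (epsStrategy ε) k)) = σ := by
    funext k
    rcases eq_or_ne k i with rfl | hk
    · simp [hφ, relabelStrategy_flipReport_epsStrategy, hσi]
    · simp [hφ, hk, relabelStrategy_one]
  refine ⟨relabelMechanism φ R, fun x j => hR _ j,
    NashEq.of_relabel (fun k => ?_) (hprofile.symm ▸ hNE), fun j => ?_⟩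
  · rcases eq_or_ne k i with rfl | hk
    · simpa using isStrategy_epsStrategy ε
    · simpa [hk] using hNE.1 k
  · rw [expPay_relabelMechanism, hprofile]
end

section
/- The genie-aided mechanism R̂^(ε) achieves the lower bound: for any ε > 0, under the genie-aided mechanism R̂^(ε), for each individual i the ε-strategy σ_i^{(ε)} maximizes individual i's expected utility E[R̂_i^{(ε)}(X_i, W)] − g(ζ(σ_i)) over all strategies σ_i, and the expected payment at the ε-strategy equals the lower bound: E_{σ_i^{(ε)}}[R̂_i^{(ε)}(X_i, W)] = V_LB(ε) = g'(ε)·((e^ε+1)/e^ε)·((θ/(2θ−1))·(e^ε+1) − 1). -/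
open Real

/-- Expected payment to a single individual with strategy `σ` under a genie-aided
mechanism `R̂ : Report × State → ℝ`:
`E[R̂(X, W)] = Σ_{w,s,x} P(w) P(s|w) σ(x|s) R̂(x,w)`. -/
noncomputable def expPayGenie1 (p θ : ℝ) (σ : Bool → Report → ℝ)
    (Rh : Report → Bool → ℝ) : ℝ :=
  ∑ w : Bool, ∑ s : Bool, ∑ x : Report,
    (if w then p else 1 - p) * signalProb θ w s * σ s x * Rh x w

/-- The genie-aided mechanism `R̂^{(ε)}`:
`R̂^{(ε)}(x,w) = (g'(ε)(e^ε+1)²/(2e^ε)) · Â_{x,w}` with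
`Â_{1,1} = 1/((2θ−1)P_W(1))`, `Â_{0,0} = 1/((2θ−1)P_W(0))` and all the other `Â` zero. -/
noncomputable def genieMech (p θ : ℝ) (g' : ℝ → ℝ) (ε : ℝ) : Report → Bool → ℝ :=
  fun x w =>
    (g' ε * (Real.exp ε + 1)^2 / (2 * Real.exp ε)) *
      (match x, w with
        | some true, true => 1 / ((2 * θ - 1) * p)
        | some false, false => 1 / ((2 * θ - 1) * (1 - p))
        | _, _ => 0)

lemma ConvexOn.add_mul_sub_le_of_hasDerivAt {S : Set ℝ} {f : ℝ → ℝ} {f' x y : ℝ}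
    (hfc : ConvexOn ℝ S f) (hx : x ∈ S) (hy : y ∈ S) (hf : HasDerivAt f f' x) :
    f x + f' * (y - x) ≤ f y := by
  rcases lt_trichotomy x y with h | rfl | h
  · have := hfc.le_slope_of_hasDerivAt hx hy h hf
    rw [slope_def_field, le_div_iff₀ (sub_pos.2 h)] at this
    linarith
  · simp
  · have := hfc.slope_le_of_hasDerivAt hy hx h hf
    rw [slope_def_field, div_le_iff₀ (sub_pos.2 h)] at this
    linarith

lemma half_le_sigmoid {x : ℝ} (hx : 0 ≤ x) : 1 / 2 ≤ sigmoid x := by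
  have := Real.sigmoid_le hx
  rw [Real.sigmoid_zero] at this
  linarith

lemma concaveOn_sigmoid : ConcaveOn ℝ (Set.Ici 0) sigmoid := by
  refine AntitoneOn.concaveOn_of_deriv (convex_Ici 0) continuous_sigmoid.continuousOn
    differentiable_sigmoid.differentiableOn ?_
  rw [Real.deriv_sigmoid]
  intro x hx y _ hxy
  have hx0 : 0 ≤ x := interior_subset hx
  have h1 := half_le_sigmoid hx0
  have h2 := Real.sigmoid_le hxy
  show sigmoid y * (1 - sigmoid y) ≤ sigmoid x * (1 - sigmoid x)
  nlinarith

lemma sigmoid_le_tangent {x y : ℝ} (hx : 0 ≤ x) (hy : 0 ≤ y) :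
    sigmoid y ≤ sigmoid x + sigmoid x * (1 - sigmoid x) * (y - x) := by
  have := concaveOn_sigmoid.neg.add_mul_sub_le_of_hasDerivAt hx hy (Real.hasDerivAt_sigmoid x).neg
  simp only [Pi.neg_apply] at this
  linarith

lemma sigmoid_eq_exp_div (x : ℝ) : sigmoid x = exp x / (exp x + 1) := by
  have := exp_pos x
  rw [Real.sigmoid_def, exp_neg]
  field_simp

lemma exp_mul_one_sub_sigmoid (x : ℝ) : exp x * (1 - sigmoid x) = sigmoid x := by
  have := exp_pos x
  rw [sigmoid_eq_exp_div]
  field_simp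
  ring

lemma llr_le_ofReal_iff {a b ξ : ℝ} (ha : 0 ≤ a) (hb : 0 ≤ b) (hξ : 0 ≤ ξ) :
    llr a b ≤ ENNReal.ofReal ξ ↔ a ≤ exp ξ * b := by
  unfold llr
  rcases hb.eq_or_lt with rfl | hb
  · rcases ha.eq_or_lt with rfl | ha
    · simp
    · simp [ha.ne', ha]
  · rw [if_neg (fun h => hb.ne' h.2), if_neg hb.ne', ENNReal.ofReal_le_ofReal_iff hξ]
    rcases ha.eq_or_lt with rfl | ha
    · simp only [zero_div, Real.log_zero, hξ, true_iff]
      positivity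
    · rw [Real.log_le_iff_le_exp (div_pos ha hb), div_le_iff₀ hb]

lemma probE_nonneg {σ : Bool → Report → ℝ} (hσ : ∀ s x, 0 ≤ σ s x) (E : Finset Report)
    (s : Bool) : 0 ≤ probE σ E s :=
  Finset.sum_nonneg fun x _ => hσ s x

lemma privLevel_le_ofReal_iff {σ : Bool → Report → ℝ} (hσ : ∀ s x, 0 ≤ σ s x) {ξ : ℝ}
    (hξ : 0 ≤ ξ) :
    privLevel σ ≤ ENNReal.ofReal ξ ↔ ∀ s x, σ s x ≤ exp ξ * σ (!s) x := by
  simp only [privLevel, iSup_le_iff,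
    llr_le_ofReal_iff (probE_nonneg hσ _ _) (probE_nonneg hσ _ _) hξ]
  constructor
  · intro h s x
    simpa [probE] using h {x} s
  · intro h E s
    rw [probE, probE, Finset.mul_sum]
    exact Finset.sum_le_sum fun x _ => h s x

lemma epsStrategy_nonneg (ε : ℝ) (s : Bool) (x : Report) : 0 ≤ epsStrategy ε s x := by
  rcases x with _ | b
  · exact le_rfl
  · simp only [epsStrategy]
    split_ifs <;> positivity

lemma privLevel_epsStrategy_le {ε : ℝ} (hε : 0 ≤ ε) :
    privLevel (epsStrategy ε) ≤ ENNReal.ofReal ε := by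
  rw [privLevel_le_ofReal_iff (epsStrategy_nonneg ε) hε]
  have h1 := one_le_exp hε
  have key : 1 / (exp ε + 1) ≤ exp ε * (exp ε / (exp ε + 1)) := by
    rw [← mul_div_assoc]
    gcongr
    nlinarith
  have key' : exp ε / (exp ε + 1) ≤ exp ε * (1 / (exp ε + 1)) := by
    rw [mul_one_div]
  rintro s (_ | b)
  · simp [epsStrategy]
  · cases s <;> cases b <;> simp [epsStrategy, -one_div, key, key']

lemma privCost_epsStrategy_le {g g' : ℝ → ℝ} (hg : ProperCost g g') {ε : ℝ} (hε : 0 ≤ ε) :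
    privCost g (epsStrategy ε) ≤ (g ε : EReal) := by
  have h := privLevel_epsStrategy_le hε
  rw [privCost, if_neg (h.trans_lt ENNReal.ofReal_lt_top).ne, EReal.coe_le_coe_iff]
  exact hg.mono ENNReal.toReal_nonneg hε (ENNReal.toReal_le_of_le_ofReal hε h)

lemma ProperCost.deriv_pos {g g' : ℝ → ℝ} (hg : ProperCost g g') {x : ℝ} (hx : 0 < x) :
    0 < g' x := by
  have h := hg.conv.add_mul_sub_le_of_hasDerivAt hx.le (Set.self_mem_Ici (a := (0 : ℝ)))
    (hg.deriv x hx.le)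
  rw [hg.zero] at h
  have := hg.pos x hx
  exact pos_of_mul_pos_left (by linarith : 0 < g' x * x) hx.le

lemma ProperCost.iSup_eq_top {g g' : ℝ → ℝ} (hg : ProperCost g g') :
    ⨆ x ∈ Set.Ici (0 : ℝ), (g x : EReal) = ⊤ := by
  rw [EReal.eq_top_iff_forall_lt]
  intro y
  have hd := hg.deriv_pos one_pos
  have hz : (0 : ℝ) ≤ 1 + |y| / g' 1 := by positivity
  have h := hg.conv.add_mul_sub_le_of_hasDerivAt (Set.mem_Ici.2 zero_le_one) hz
    (hg.deriv 1 (Set.mem_Ici.2 zero_le_one))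
  rw [add_sub_cancel_left, mul_div_cancel₀ _ hd.ne'] at h
  have := hg.pos 1 one_pos
  have hy : y < g (1 + |y| / g' 1) := by linarith [le_abs_self y]
  exact (EReal.coe_lt_coe_iff.2 hy).trans_le
    (le_iSup₂ (f := fun x (_ : x ∈ Set.Ici (0 : ℝ)) => (g x : EReal)) _ hz)

lemma expPayGenie1_genieMech {p θ : ℝ} (hp0 : p ≠ 0) (hp1 : 1 - p ≠ 0) (g' : ℝ → ℝ) (ε : ℝ)
    (σ : Bool → Report → ℝ) :
    expPayGenie1 p θ σ (genieMech p θ g' ε) =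
      g' ε * (exp ε + 1) ^ 2 / (2 * exp ε) / (2 * θ - 1) *
        (θ * (σ true (some true) + σ false (some false)) +
          (1 - θ) * (σ false (some true) + σ true (some false))) := by
  simp [expPayGenie1, genieMech, signalProb, Fintype.sum_option]
  rcases eq_or_ne (2 * θ - 1) 0 with h | h
  · simp [h]
  · field_simp
    ring

lemma two_mul_gain_mul_sigmoid_deriv (c ε : ℝ) :
    2 * (c * (exp ε + 1) ^ 2 / (2 * exp ε)) * (sigmoid ε * (1 - sigmoid ε)) = c := by
  have := exp_pos ε
  rw [sigmoid_eq_exp_div]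
  field_simp
  ring

lemma expPayGenie1_epsStrategy {p θ : ℝ} (hp0 : p ≠ 0) (hp1 : 1 - p ≠ 0) (g' : ℝ → ℝ) (ε : ℝ) :
    expPayGenie1 p θ (epsStrategy ε) (genieMech p θ g' ε) =
      g' ε * (exp ε + 1) ^ 2 / (2 * exp ε) / (2 * θ - 1) *
        (2 * (2 * θ - 1) * sigmoid ε + 2 * (1 - θ)) := by
  have := exp_pos ε
  rw [expPayGenie1_genieMech hp0 hp1, sigmoid_eq_exp_div]
  simp only [epsStrategy]
  simp
  left
  field_simp
  ring

lemma agreement_le_two_mul_sigmoid {σ : Bool → Report → ℝ} {ξ : ℝ}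
    (hξ : ∀ s x, σ s x ≤ exp ξ * σ (!s) x)
    (hsum : σ true (some true) + σ false (some false) +
      (σ false (some true) + σ true (some false)) ≤ 2) :
    σ true (some true) + σ false (some false) ≤ 2 * sigmoid ξ := by
  have h1 := hξ true (some true)
  have h2 := hξ false (some false)
  simp only [Bool.not_true, Bool.not_false] at h1 h2
  set u := σ true (some true) + σ false (some false) with hu
  set v := σ false (some true) + σ true (some false) with hv
  have h : u ≤ exp ξ * v := by rw [hu, hv, mul_add]; linarith
  have h3 := mul_le_mul_of_nonneg_right h (sub_nonneg.2 (Real.sigmoid_le_one ξ))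
  rw [mul_right_comm, exp_mul_one_sub_sigmoid] at h3
  nlinarith [Real.sigmoid_nonneg ξ]

/-- **The genie-aided mechanism `R̂^{(ε)}` achieves the lower bound:** under `R̂^{(ε)}`,
the `ε`-strategy maximizes the individual's expected utility over all strategies, and
its expected payment equals `V_LB(ε)`. -/
theorem genie_mechanism_achieves_lower_bound
    (p θ : ℝ) (hp0 : 0 < p) (hp1 : p < 1)
    (hθ : 1/2 < θ) (hθ1 : θ < 1)
    (g g' : ℝ → ℝ) (hg : ProperCost g g')
    (ε : ℝ) (hε : 0 < ε) :
    (∀ σ' : Bool → Report → ℝ, IsStrategy σ' →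
      ((expPayGenie1 p θ σ' (genieMech p θ g' ε) : ℝ) : EReal) - privCost g σ' ≤
      ((expPayGenie1 p θ (epsStrategy ε) (genieMech p θ g' ε) : ℝ) : EReal) -
        privCost g (epsStrategy ε)) ∧
    expPayGenie1 p θ (epsStrategy ε) (genieMech p θ g' ε) = VLB θ g' ε := by
  have hp1' : 1 - p ≠ 0 := (sub_pos.2 hp1).ne'
  have ht : 0 < 2 * θ - 1 := by linarith
  refine ⟨fun σ ⟨hσ, hσ1⟩ => ?_, ?_⟩
  · by_cases htop : privLevel σ = ⊤
    · rw [privCost, if_pos htop, hg.iSup_eq_top, EReal.sub_top]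
      exact bot_le
    refine le_trans ?_ (EReal.sub_le_sub le_rfl (privCost_epsStrategy_le hg hε.le))
    rw [privCost, if_neg htop, ← EReal.coe_sub, ← EReal.coe_sub, EReal.coe_le_coe_iff,
      expPayGenie1_epsStrategy hp0.ne' hp1', expPayGenie1_genieMech hp0.ne' hp1']
    set ξ := (privLevel σ).toReal
    have hξ : 0 ≤ ξ := ENNReal.toReal_nonneg
    have hsum : σ true (some true) + σ false (some false) +
        (σ false (some true) + σ true (some false)) ≤ 2 := by
      have h1 := hσ1 true
      have h2 := hσ1 false
      simp only [Fintype.sum_option, Fintype.sum_bool] at h1 h2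
      linarith [hσ true none, hσ false none]
    have hu := agreement_le_two_mul_sigmoid
      ((privLevel_le_ofReal_iff hσ hξ).1 (ENNReal.ofReal_toReal htop).ge) hsum
    have hd := hg.deriv_pos hε
    have hgain := two_mul_gain_mul_sigmoid_deriv (g' ε) ε
    have hK : 0 < g' ε * (exp ε + 1) ^ 2 / (2 * exp ε) := by positivity
    set K := g' ε * (exp ε + 1) ^ 2 / (2 * exp ε)
    set u := σ true (some true) + σ false (some false)
    set v := σ false (some true) + σ true (some false)
    have hpay : K / (2 * θ - 1) * (θ * u + (1 - θ) * v) ≤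
        K / (2 * θ - 1) * (2 * (2 * θ - 1) * sigmoid ξ + 2 * (1 - θ)) := by
      refine mul_le_mul_of_nonneg_left ?_ (by positivity)
      nlinarith
    have hsplit (x : ℝ) : K / (2 * θ - 1) * (2 * (2 * θ - 1) * sigmoid x + 2 * (1 - θ)) =
        2 * K * sigmoid x + K / (2 * θ - 1) * (2 * (1 - θ)) := by
      field_simp
    rw [hsplit] at hpay ⊢
    have hs := mul_le_mul_of_nonneg_left (sigmoid_le_tangent hε.le hξ) (by positivity : 0 ≤ 2 * K)
    rw [mul_add, ← mul_assoc, hgain] at hs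
    have hgt := hg.conv.add_mul_sub_le_of_hasDerivAt hε.le hξ (hg.deriv ε hε.le)
    linarith
  · have := exp_pos ε
    rw [expPayGenie1_epsStrategy hp0.ne' hp1', sigmoid_eq_exp_div, VLB]
    field_simp
    ring
end
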